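/- arXiv:2301.04948 — 2 statements merged into one kernel-verified Lean document; each statement's English description precedes it below -/
import Mathlib

section
/- Let d ≥ 2 and let μ be the Haar probability measure on the compact group U(d) of d×d complex unitary matrices. Then for all indices i₁, i₂, j₁, j₂, k₁, k₂, l₁, l₂ ∈ {1,…,d}, the second-moment integral satisfies ∫ U_{i₁j₁} U_{i₂j₂} conj(U_{k₁l₁}) conj(U_{k₂l₂}) dμ(U) = (1/(d²−1)) (δ_{i₁k₁}δ_{i₂k₂}δ_{j₁l₁}δ_{j₂l₂} + δ_{i₁k₂}δ_{i₂k₁}δ_{j₁l₂}δ_{j₂l₁}) − (1/(d(d²−1))) (δ_{i₁k₁}δ_{i₂k₂}δ_{j₁l₂}δ_{j₂l₁} + δ_{i₁k₂}δ_{i₂k₁}δ_{j₁l₁}δ_{j₂l₂}). -/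
open MeasureTheory Matrix

namespace HaarMoment

variable {n : Type*} [Fintype n] [DecidableEq n]

/-- A four-index tensor is invariant under `T ↦ (W ⊗ W) T (W ⊗ W)ᴴ` for every unitary `W`. -/
def IsConjInvariant (T : n → n → n → n → ℂ) : Prop :=
  ∀ W ∈ Matrix.unitaryGroup n ℂ, ∀ i₁ i₂ k₁ k₂,
    T i₁ i₂ k₁ k₂ = ∑ p, W i₁ p * ∑ q, W i₂ q * ∑ r, (starRingEnd ℂ) (W k₁ r) *
      ∑ s, (starRingEnd ℂ) (W k₂ s) * T p q r s

lemma diagonal_mem_unitaryGroup {f : n → ℂ} (hf : ∀ i, f i * (starRingEnd ℂ) (f i) = 1) :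
    diagonal f ∈ Matrix.unitaryGroup n ℂ := by
  rw [Matrix.mem_unitaryGroup_iff, star_eq_conjTranspose, diagonal_conjTranspose,
    diagonal_mul_diagonal, ← diagonal_one]
  congr 1
  funext i
  exact hf i

lemma permMatrix_mem_unitaryGroup (σ : Equiv.Perm n) :
    σ.permMatrix ℂ ∈ Matrix.unitaryGroup n ℂ := by
  rw [Matrix.mem_unitaryGroup_iff, star_eq_conjTranspose, conjTranspose_permMatrix,
    ← permMatrix_mul, inv_mul_cancel, permMatrix_one]

lemma smul_one_add_smul_permMatrix_swap_mem_unitaryGroup (a b : n) :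
    ((1 + Complex.I) / 2) • (1 : Matrix n n ℂ) +
      ((Complex.I - 1) / 2) • (Equiv.swap a b).permMatrix ℂ ∈ Matrix.unitaryGroup n ℂ := by
  have hS : (Equiv.swap a b).permMatrix ℂ * (Equiv.swap a b).permMatrix ℂ = 1 := by
    rw [← permMatrix_mul, Equiv.swap_mul_self, permMatrix_one]
  rw [Matrix.mem_unitaryGroup_iff, star_eq_conjTranspose, conjTranspose_add, conjTranspose_smul,
    conjTranspose_smul, conjTranspose_permMatrix, conjTranspose_one, Equiv.swap_inv]
  simp only [mul_add, add_mul, smul_mul_smul_comm, hS, one_mul, mul_one]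
  have h₁ : (1 + Complex.I) / 2 * star ((1 + Complex.I) / 2) +
      (Complex.I - 1) / 2 * star ((Complex.I - 1) / 2) = 1 := by
    simp
    linear_combination (-1 / 2) * Complex.I_sq
  have h₂ : (1 + Complex.I) / 2 * star ((Complex.I - 1) / 2) +
      (Complex.I - 1) / 2 * star ((1 + Complex.I) / 2) = 0 := by
    simp
    linear_combination (-1 / 2) * Complex.I_sq
  calc _ = ((1 + Complex.I) / 2 * star ((1 + Complex.I) / 2) +
          (Complex.I - 1) / 2 * star ((Complex.I - 1) / 2)) • (1 : Matrix n n ℂ) +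
        ((1 + Complex.I) / 2 * star ((Complex.I - 1) / 2) +
          (Complex.I - 1) / 2 * star ((1 + Complex.I) / 2)) •
            (Equiv.swap a b).permMatrix ℂ := by module
    _ = 1 := by rw [h₁, h₂, one_smul, zero_smul, add_zero]

namespace IsConjInvariant

variable {T : n → n → n → n → ℂ}

lemma eq_phase_mul (hT : IsConjInvariant T) (m i₁ i₂ k₁ k₂ : n) :
    T i₁ i₂ k₁ k₂ = (if i₁ = m then Complex.I else 1) * ((if i₂ = m then Complex.I else 1) *
      ((if k₁ = m then -Complex.I else 1) * ((if k₂ = m then -Complex.I else 1) *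
        T i₁ i₂ k₁ k₂))) := by
  have h := hT _ (diagonal_mem_unitaryGroup (f := fun i => if i = m then Complex.I else 1)
    (fun i => by split_ifs <;> simp)) i₁ i₂ k₁ k₂
  simpa [diagonal_apply, apply_ite (starRingEnd ℂ)] using h

lemma apply_perm (hT : IsConjInvariant T) (σ : Equiv.Perm n) (i₁ i₂ k₁ k₂ : n) :
    T i₁ i₂ k₁ k₂ = T (σ i₁) (σ i₂) (σ k₁) (σ k₂) := by
  have h := hT _ (permMatrix_mem_unitaryGroup σ) i₁ i₂ k₁ k₂
  simpa [Equiv.Perm.permMatrix, PEquiv.toMatrix_apply, apply_ite (starRingEnd ℂ)] using h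

lemma eq_zero (hT : IsConjInvariant T) {i₁ i₂ k₁ k₂ : n} (h₁ : ¬(i₁ = k₁ ∧ i₂ = k₂))
    (h₂ : ¬(i₁ = k₂ ∧ i₂ = k₁)) : T i₁ i₂ k₁ k₂ = 0 := by
  have hI : (1 : ℂ) - Complex.I ≠ 0 := fun h => by simpa using congrArg Complex.re h
  have e₁ := hT.eq_phase_mul i₁ i₁ i₂ k₁ k₂
  have e₂ := hT.eq_phase_mul i₂ i₁ i₂ k₁ k₂
  have key : ∀ x : ℂ, x = Complex.I * x → x = 0 := fun x hx =>
    (mul_eq_zero.mp (show (1 - Complex.I) * x = 0 by linear_combination hx)).resolve_left hI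
  have key' : ∀ x : ℂ, x = Complex.I * (Complex.I * x) → x = 0 := fun x hx => by
    linear_combination (1 / 2) * hx + (x / 2) * Complex.I_sq
  by_cases a : i₁ = k₁
  · subst a
    have hk : i₂ ≠ k₂ := fun h => h₁ ⟨rfl, h⟩
    by_cases c : i₂ = i₁
    · subst c
      refine key _ ?_
      simp only [if_true, if_neg hk.symm] at e₁
      linear_combination e₁ - Complex.I * T i₂ i₂ i₂ k₂ * Complex.I_sq
    · refine key _ ?_
      simpa [c, Ne.symm c, hk.symm] using e₂
  by_cases b : i₁ = k₂
  · subst b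
    have hk : i₂ ≠ k₁ := fun h => h₂ ⟨rfl, h⟩
    by_cases c : i₂ = i₁
    · subst c
      refine key _ ?_
      simp only [if_true, if_neg hk.symm] at e₁
      linear_combination e₁ - Complex.I * T i₂ i₂ k₁ i₂ * Complex.I_sq
    · refine key _ ?_
      simpa only [if_true, if_neg (Ne.symm c), if_neg hk.symm, one_mul] using e₂
  by_cases c : i₂ = i₁
  · refine key' _ ?_
    simpa only [c, if_true, if_neg (Ne.symm a), if_neg (Ne.symm b), one_mul] using e₁
  · refine key _ ?_
    simpa only [c, if_true, if_false, if_neg (Ne.symm a), if_neg (Ne.symm b), one_mul] using e₁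

omit [Fintype n] in
lemma exists_perm_apply_eq {a b i j : n} (hab : a ≠ b) (hij : i ≠ j) :
    ∃ σ : Equiv.Perm n, σ i = a ∧ σ j = b := by
  refine ⟨Equiv.swap (Equiv.swap i a j) b * Equiv.swap i a, ?_, ?_⟩
  · rw [Equiv.Perm.mul_apply, Equiv.swap_apply_left]
    refine Equiv.swap_apply_of_ne_of_ne (fun h => hij ?_) hab
    exact (Equiv.swap i a).injective (by rw [Equiv.swap_apply_left, ← h])
  · rw [Equiv.Perm.mul_apply, Equiv.swap_apply_left]

lemma apply_self (hT : IsConjInvariant T) {a b : n} (hab : a ≠ b) :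
    T a a a a = T a b a b + T a b b a := by
  have h := hT _ (smul_one_add_smul_permMatrix_swap_mem_unitaryGroup a b) a a a a
  have hsum : ∀ f : n → ℂ, ∑ p, (((1 + Complex.I) / 2) • (1 : Matrix n n ℂ) +
      ((Complex.I - 1) / 2) • (Equiv.swap a b).permMatrix ℂ) a p * f p =
        (1 + Complex.I) / 2 * f a + (Complex.I - 1) / 2 * f b := fun f => by
    simp [Equiv.Perm.permMatrix, PEquiv.toMatrix_apply, Matrix.one_apply, add_mul,
      Finset.sum_add_distrib]
  have hsum' : ∀ f : n → ℂ, ∑ p, (starRingEnd ℂ) ((((1 + Complex.I) / 2) • (1 : Matrix n n ℂ) +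
      ((Complex.I - 1) / 2) • (Equiv.swap a b).permMatrix ℂ) a p) * f p =
        (1 - Complex.I) / 2 * f a + (-Complex.I - 1) / 2 * f b := fun f => by
    simp [Equiv.Perm.permMatrix, PEquiv.toMatrix_apply, Matrix.one_apply, add_mul,
      Finset.sum_add_distrib, apply_ite (starRingEnd ℂ), sub_eq_add_neg, Complex.conj_ofNat]
  simp only [hsum, hsum'] at h
  have s₁ := hT.apply_perm (Equiv.swap a b) b b b b
  have s₂ := hT.apply_perm (Equiv.swap a b) b a b a
  have s₃ := hT.apply_perm (Equiv.swap a b) b a a b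
  simp only [Equiv.swap_apply_left, Equiv.swap_apply_right] at s₁ s₂ s₃
  have z : ∀ i₁ i₂ k₁ k₂, ¬(i₁ = k₁ ∧ i₂ = k₂) → ¬(i₁ = k₂ ∧ i₂ = k₁) → T i₁ i₂ k₁ k₂ = 0 :=
    fun _ _ _ _ h₁ h₂ => hT.eq_zero h₁ h₂
  rw [s₁, s₂, s₃, z a a a b, z a a b a, z a a b b, z a b a a, z a b b b, z b a a a, z b a b b,
    z b b a a, z b b a b, z b b b a] at h
  · have hI4 := Complex.I_pow_four
    ring_nf at h
    simp only [hI4, Complex.I_sq] at h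
    linear_combination 2 * h
  all_goals simp [hab, hab.symm]

/-- The commutant of `W ↦ W ⊗ W` is spanned by the identity and the swap. -/
lemma eq_add_mul (hT : IsConjInvariant T) {a b : n} (hab : a ≠ b) (i₁ i₂ k₁ k₂ : n) :
    T i₁ i₂ k₁ k₂ = T a b a b * ((if i₁ = k₁ then 1 else 0) * (if i₂ = k₂ then 1 else 0)) +
      T a b b a * ((if i₁ = k₂ then 1 else 0) * (if i₂ = k₁ then 1 else 0)) := by
  by_cases hi : i₁ = i₂
  · subst hi
    by_cases h : i₁ = k₁ ∧ i₁ = k₂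
    · obtain ⟨rfl, rfl⟩ := h
      rw [hT.apply_perm (Equiv.swap i₁ a), Equiv.swap_apply_left, hT.apply_self hab]
      simp
    · rw [hT.eq_zero h (by tauto)]
      simp only [← ite_and, mul_ite, mul_one, mul_zero]
      rw [if_neg (by tauto), if_neg (by tauto), add_zero]
  · obtain ⟨σ, rfl, rfl⟩ := exists_perm_apply_eq hab hi
    rw [← hT.apply_perm, ← hT.apply_perm]
    by_cases h₁ : i₁ = k₁ ∧ i₂ = k₂
    · obtain ⟨rfl, rfl⟩ := h₁
      simp [hi]
    by_cases h₂ : i₁ = k₂ ∧ i₂ = k₁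
    · obtain ⟨rfl, rfl⟩ := h₂
      simp [hi]
    rw [hT.eq_zero h₁ h₂]
    simp only [← ite_and, mul_ite, mul_one, mul_zero]
    rw [if_neg (by tauto), if_neg (by tauto), add_zero]

end IsConjInvariant

omit [DecidableEq n] in
lemma sum_mul_sum_mul_sum_mul_sum (c₁ c₂ c₃ c₄ u v x y : n → ℂ) :
    ∑ p, c₁ p * ∑ q, c₂ q * ∑ r, c₃ r * ∑ s, c₄ s * (u p * v q * x r * y s) =
      (∑ p, c₁ p * u p) * (∑ p, c₂ p * v p) * (∑ p, c₃ p * x p) * ∑ p, c₄ p * y p := by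
  have key : ∀ (c f : n → ℂ) (a b : ℂ), ∑ p, c p * (a * f p * b) = a * (∑ p, c p * f p) * b :=
    fun c f a b => by
      rw [Finset.mul_sum, Finset.sum_mul]
      exact Finset.sum_congr rfl fun p _ => by ring
  have h₄ : ∀ a, ∑ s, c₄ s * (a * y s) = a * ∑ s, c₄ s * y s := fun a => by
    simpa using key c₄ y a 1
  have h₂ : ∀ a b d, ∑ q, c₂ q * (a * v q * b * d) = a * (∑ q, c₂ q * v q) * b * d :=
    fun a b d => by simpa only [mul_assoc] using key c₂ v a (b * d)
  simp only [h₄, key, h₂]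
  simpa only [one_mul, mul_assoc] using key c₁ u 1
    ((∑ p, c₂ p * v p) * ((∑ p, c₃ p * x p) * ∑ p, c₄ p * y p))

variable [MeasurableSpace (Matrix.unitaryGroup n ℂ)] [BorelSpace (Matrix.unitaryGroup n ℂ)]
  (μ : Measure (Matrix.unitaryGroup n ℂ))

/-- The integrand of the second moment. -/
def integrand (j₁ j₂ l₁ l₂ i₁ i₂ k₁ k₂ : n) (U : Matrix.unitaryGroup n ℂ) : ℂ :=
  (U : Matrix n n ℂ) i₁ j₁ * (U : Matrix n n ℂ) i₂ j₂ *
    (starRingEnd ℂ) ((U : Matrix n n ℂ) k₁ l₁) * (starRingEnd ℂ) ((U : Matrix n n ℂ) k₂ l₂)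

lemma integrable_integrand [IsFiniteMeasure μ] (j₁ j₂ l₁ l₂ i₁ i₂ k₁ k₂ : n) :
    Integrable (integrand j₁ j₂ l₁ l₂ i₁ i₂ k₁ k₂) μ := by
  have hc : ∀ i j, Continuous fun U : Matrix.unitaryGroup n ℂ => (U : Matrix n n ℂ) i j :=
    fun i j => continuous_subtype_val.matrix_elem i j
  refine Integrable.of_bound (Continuous.aestronglyMeasurable ?_) 1 (ae_of_all _ fun U => ?_)
  · exact (((hc _ _).mul (hc _ _)).mul (Complex.continuous_conj.comp (hc _ _))).mul
      (Complex.continuous_conj.comp (hc _ _))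
  · have hb := fun i j => entry_norm_bound_of_unitary U.2 i j
    simp only [integrand, norm_mul, RCLike.norm_conj]
    have h := fun i j => norm_nonneg ((U : Matrix n n ℂ) i j)
    exact mul_le_one₀ (mul_le_one₀ (mul_le_one₀ (hb _ _) (h _ _) (hb _ _)) (h _ _) (hb _ _))
      (h _ _) (hb _ _)

lemma isConjInvariant_integral [IsFiniteMeasure μ] [μ.IsMulLeftInvariant] (j₁ j₂ l₁ l₂ : n) :
    IsConjInvariant fun i₁ i₂ k₁ k₂ => ∫ U, integrand j₁ j₂ l₁ l₂ i₁ i₂ k₁ k₂ U ∂μ := by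
  intro W hW i₁ i₂ k₁ k₂
  have hint := integrable_integrand μ j₁ j₂ l₁ l₂
  have hmul : ∀ U, integrand j₁ j₂ l₁ l₂ i₁ i₂ k₁ k₂ ((⟨W, hW⟩ : Matrix.unitaryGroup n ℂ) * U) =
      ∑ p, W i₁ p * ∑ q, W i₂ q * ∑ r, (starRingEnd ℂ) (W k₁ r) *
        ∑ s, (starRingEnd ℂ) (W k₂ s) * integrand j₁ j₂ l₁ l₂ p q r s U := fun U => by
    simp only [integrand, Matrix.UnitaryGroup.mul_val, Matrix.mul_apply, map_sum, map_mul]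
    exact (sum_mul_sum_mul_sum_mul_sum _ _ _ _ _ _ _ _).symm
  have h₄ : ∀ p q r, Integrable (fun U => ∑ s, (starRingEnd ℂ) (W k₂ s) *
      integrand j₁ j₂ l₁ l₂ p q r s U) μ :=
    fun p q r => integrable_finsetSum _ fun s _ => (hint p q r s).const_mul _
  have h₃ : ∀ p q, Integrable (fun U => ∑ r, (starRingEnd ℂ) (W k₁ r) *
      ∑ s, (starRingEnd ℂ) (W k₂ s) * integrand j₁ j₂ l₁ l₂ p q r s U) μ :=
    fun p q => integrable_finsetSum _ fun r _ => (h₄ p q r).const_mul _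
  have h₂ : ∀ p, Integrable (fun U => ∑ q, W i₂ q * ∑ r, (starRingEnd ℂ) (W k₁ r) *
      ∑ s, (starRingEnd ℂ) (W k₂ s) * integrand j₁ j₂ l₁ l₂ p q r s U) μ :=
    fun p => integrable_finsetSum _ fun q _ => (h₃ p q).const_mul _
  beta_reduce
  rw [← integral_mul_left_eq_self _ (⟨W, hW⟩ : Matrix.unitaryGroup n ℂ)]
  simp only [hmul]
  rw [integral_finsetSum _ fun p _ => (h₂ p).const_mul _]
  refine Finset.sum_congr rfl fun p _ => ?_
  rw [integral_const_mul, integral_finsetSum _ fun q _ => (h₃ p q).const_mul _]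
  congr 1
  refine Finset.sum_congr rfl fun q _ => ?_
  rw [integral_const_mul, integral_finsetSum _ fun r _ => (h₄ p q r).const_mul _]
  congr 1
  refine Finset.sum_congr rfl fun r _ => ?_
  rw [integral_const_mul, integral_finsetSum _ fun s _ => (hint p q r s).const_mul _]
  simp only [integral_const_mul]

omit [MeasurableSpace (Matrix.unitaryGroup n ℂ)] [BorelSpace (Matrix.unitaryGroup n ℂ)] in
lemma sum_mul_conj (U : Matrix.unitaryGroup n ℂ) (j l : n) :
    ∑ i, (U : Matrix n n ℂ) i j * (starRingEnd ℂ) ((U : Matrix n n ℂ) i l) =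
      if j = l then 1 else 0 := by
  have h := congrFun (congrFun (Matrix.UnitaryGroup.star_mul_self U) l) j
  rw [Matrix.mul_apply, Matrix.one_apply] at h
  simp only [Matrix.star_apply, RCLike.star_def] at h
  simpa only [mul_comm, eq_comm] using h

lemma sum_sum_integral_integrand [IsProbabilityMeasure μ] (j₁ j₂ l₁ l₂ : n) :
    ∑ i, ∑ k, ∫ U, integrand j₁ j₂ l₁ l₂ i k i k U ∂μ =
      (if j₁ = l₁ then 1 else 0) * (if j₂ = l₂ then 1 else 0) := by
  have hint := integrable_integrand μ j₁ j₂ l₁ l₂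
  simp_rw [← integral_finsetSum _ fun k _ => hint _ k _ k]
  rw [← integral_finsetSum _ fun i _ => integrable_finsetSum _ fun k _ => hint i k i k]
  have h : ∀ U, ∑ i, ∑ k, integrand j₁ j₂ l₁ l₂ i k i k U =
      (if j₁ = l₁ then 1 else 0) * (if j₂ = l₂ then 1 else 0) := fun U => by
    rw [← sum_mul_conj U j₁ l₁, ← sum_mul_conj U j₂ l₂, Finset.sum_mul_sum]
    refine Finset.sum_congr rfl fun i _ => Finset.sum_congr rfl fun k _ => ?_
    rw [integrand]
    ring
  simp only [h, integral_const, probReal_univ, one_smul]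

omit [MeasurableSpace (Matrix.unitaryGroup n ℂ)] [BorelSpace (Matrix.unitaryGroup n ℂ)] in
lemma integrand_swap (j₁ j₂ l₁ l₂ i₁ i₂ k₁ k₂ : n) (U : Matrix.unitaryGroup n ℂ) :
    integrand j₁ j₂ l₁ l₂ i₁ i₂ k₁ k₂ U = integrand j₁ j₂ l₂ l₁ i₁ i₂ k₂ k₁ U := by
  simp only [integrand]
  ring

end HaarMoment

/-- Weingarten second-moment formula for the Haar measure on `U(d)`:
`∫ U_{i₁j₁} U_{i₂j₂} conj(U_{k₁l₁}) conj(U_{k₂l₂}) dμ(U)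
  = (1/(d²−1)) (δ_{i₁k₁}δ_{i₂k₂}δ_{j₁l₁}δ_{j₂l₂} + δ_{i₁k₂}δ_{i₂k₁}δ_{j₁l₂}δ_{j₂l₁})
    − (1/(d(d²−1))) (δ_{i₁k₁}δ_{i₂k₂}δ_{j₁l₂}δ_{j₂l₁} + δ_{i₁k₂}δ_{i₂k₁}δ_{j₁l₁}δ_{j₂l₂})`. -/
theorem haar_unitary_second_moment (d : ℕ) (hd : 2 ≤ d)
    [MeasurableSpace (Matrix.unitaryGroup (Fin d) ℂ)]
    [BorelSpace (Matrix.unitaryGroup (Fin d) ℂ)]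
    (μ : Measure (Matrix.unitaryGroup (Fin d) ℂ))
    [μ.IsHaarMeasure] [IsProbabilityMeasure μ]
    (i₁ i₂ j₁ j₂ k₁ k₂ l₁ l₂ : Fin d) :
    ∫ U : Matrix.unitaryGroup (Fin d) ℂ,
        (U : Matrix (Fin d) (Fin d) ℂ) i₁ j₁ * (U : Matrix (Fin d) (Fin d) ℂ) i₂ j₂ *
          (starRingEnd ℂ) ((U : Matrix (Fin d) (Fin d) ℂ) k₁ l₁) *
          (starRingEnd ℂ) ((U : Matrix (Fin d) (Fin d) ℂ) k₂ l₂) ∂μ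
      = (1 / ((d : ℂ) ^ 2 - 1)) *
          ((if i₁ = k₁ then 1 else 0) * (if i₂ = k₂ then 1 else 0) *
              (if j₁ = l₁ then 1 else 0) * (if j₂ = l₂ then 1 else 0) +
            (if i₁ = k₂ then 1 else 0) * (if i₂ = k₁ then 1 else 0) *
              (if j₁ = l₂ then 1 else 0) * (if j₂ = l₁ then 1 else 0))
        - (1 / ((d : ℂ) * ((d : ℂ) ^ 2 - 1))) *
          ((if i₁ = k₁ then 1 else 0) * (if i₂ = k₂ then 1 else 0) *
              (if j₁ = l₂ then 1 else 0) * (if j₂ = l₁ then 1 else 0) +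
            (if i₁ = k₂ then 1 else 0) * (if i₂ = k₁ then 1 else 0) *
              (if j₁ = l₁ then 1 else 0) * (if j₂ = l₂ then 1 else 0)) := by
  have hT := HaarMoment.isConjInvariant_integral μ j₁ j₂ l₁ l₂
  have hab : (⟨0, by omega⟩ : Fin d) ≠ ⟨1, by omega⟩ := by simp
  have hform := hT.eq_add_mul hab
  beta_reduce at hform
  generalize (∫ U, HaarMoment.integrand j₁ j₂ l₁ l₂ ⟨0, _⟩ ⟨1, _⟩ ⟨0, _⟩ ⟨1, _⟩ U ∂μ) = A at hform
  generalize (∫ U, HaarMoment.integrand j₁ j₂ l₁ l₂ ⟨0, _⟩ ⟨1, _⟩ ⟨1, _⟩ ⟨0, _⟩ U ∂μ) = B at hform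
  have t₁ := HaarMoment.sum_sum_integral_integrand μ j₁ j₂ l₁ l₂
  have t₂ := HaarMoment.sum_sum_integral_integrand μ j₁ j₂ l₂ l₁
  simp only [HaarMoment.integrand_swap j₁ j₂ l₂ l₁] at t₂
  have hmain := hform i₁ i₂ k₁ k₂
  simp only [HaarMoment.integrand] at hmain
  rw [hmain]
  have e₁ : ∑ _x : Fin d, ∑ _y : Fin d, (1 : ℂ) = d * d := by simp
  have e₂ : ∑ x : Fin d, ∑ y : Fin d,
      ((if x = y then 1 else 0) * (if y = x then 1 else 0) : ℂ) = d := by simp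
  simp only [hform, Finset.sum_add_distrib, ← Finset.mul_sum, if_true, one_mul, e₁, e₂] at t₁ t₂
  have hd0 : (d : ℂ) ≠ 0 := by
    exact_mod_cast (by omega : d ≠ 0)
  have hd1 : (d : ℂ) ^ 2 - 1 ≠ 0 := by
    rw [sub_ne_zero]
    exact_mod_cast (by nlinarith : d ^ 2 ≠ 1)
  generalize (if j₁ = l₁ then (1 : ℂ) else 0) = x₁ at *
  generalize (if j₂ = l₂ then (1 : ℂ) else 0) = x₂ at *
  generalize (if j₁ = l₂ then (1 : ℂ) else 0) = y₁ at *
  generalize (if j₂ = l₁ then (1 : ℂ) else 0) = y₂ at *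
  generalize (if i₁ = k₁ then (1 : ℂ) else 0) * (if i₂ = k₂ then 1 else 0) = u
  generalize (if i₁ = k₂ then (1 : ℂ) else 0) * (if i₂ = k₁ then 1 else 0) = v
  have hA : A = (d * (x₁ * x₂) - y₁ * y₂) / (d * (d ^ 2 - 1)) := by
    rw [eq_div_iff (mul_ne_zero hd0 hd1)]
    linear_combination (d : ℂ) * t₁ - t₂
  have hB : B = (d * (y₁ * y₂) - x₁ * x₂) / (d * (d ^ 2 - 1)) := by
    rw [eq_div_iff (mul_ne_zero hd0 hd1)]
    linear_combination (d : ℂ) * t₂ - t₁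
  rw [hA, hB]
  field_simp
  ring
end

section
/- Let d ≥ 2 and let μ be the Haar probability measure on U(d). Then for all indices i, k, j, j', l, l' ∈ {1,…,d}: ∫ conj(U_{ji}) U_{j'i} conj(U_{lk}) U_{l'k} dμ(U) = (1/(d²−1)) [ (δ_{jj'}δ_{ll'} − (1/d) δ_{jl'}δ_{lj'}) + δ_{ik} (δ_{jl'}δ_{lj'} − (1/d) δ_{jj'}δ_{ll'}) ]. Equivalently, the Choi–Jamiołkowski matrix of the Haar-averaged doubled von Neumann measurement channel ∫ 𝒫_U ⊗ 𝒫_U dU equals (1/(d²−1)) ( 1 ⊗ (1 − S/d) + T ⊗ (S − 1/d) ), where the first tensor factor carries the output registers and the second the input registers. -/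
open MeasureTheory Matrix

section FourthMoments

variable {n : Type*} [Fintype n] [DecidableEq n]

/-- The mixed fourth moment of entries of two columns of a random unitary matrix. -/
noncomputable def columnMoment [MeasurableSpace (unitaryGroup n ℂ)]
    (μ : Measure (unitaryGroup n ℂ)) (i k j j' l l' : n) : ℂ :=
  ∫ U : unitaryGroup n ℂ, (starRingEnd ℂ) ((U : Matrix n n ℂ) j i) * (U : Matrix n n ℂ) j' i *
    (starRingEnd ℂ) ((U : Matrix n n ℂ) l k) * (U : Matrix n n ℂ) l' k ∂μ

lemma diagonal_mem_unitaryGroup {c : n → ℂ} (hc : ∀ a, star (c a) * c a = 1) :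
    diagonal c ∈ unitaryGroup n ℂ := by
  rw [mem_unitaryGroup_iff', star_eq_conjTranspose, diagonal_conjTranspose, diagonal_mul_diagonal,
    ← diagonal_one]
  congr 1
  ext a
  exact hc a

lemma permMatrix_mem_unitaryGroup (σ : Equiv.Perm n) :
    σ.permMatrix ℂ ∈ unitaryGroup n ℂ := by
  rw [mem_unitaryGroup_iff', star_eq_conjTranspose, conjTranspose_permMatrix, ← permMatrix_mul]
  simp

lemma sum_conj_mul_unitaryGroup (U : unitaryGroup n ℂ) (i k : n) :
    ∑ j, (starRingEnd ℂ) ((U : Matrix n n ℂ) j i) * (U : Matrix n n ℂ) j k =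
      if i = k then 1 else 0 := by
  have h := congrFun (congrFun (mem_unitaryGroup_iff'.1 U.2) i) k
  simpa [mul_apply, one_apply, star_apply] using h

/-- A Householder reflection in the plane spanned by two coordinate vectors prescribes the
row `(3/5, -4/5)`. -/
lemma exists_unitaryGroup_row {p q : n} (hpq : p ≠ q) :
    ∃ V : unitaryGroup n ℂ, ∀ a, (V : Matrix n n ℂ) p a =
      (if a = p then 3 / 5 else 0) + (if a = q then -4 / 5 else 0) := by
  let v : n → ℂ := Pi.single p 1 + Pi.single q 2
  have hv : v ⬝ᵥ v = 5 := by
    simp [v, hpq, hpq.symm]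
    norm_num
  have hstar : star v = v := by
    simp only [v, star_add, ← Pi.single_star, star_one, star_ofNat]
  refine ⟨⟨1 - (2 / 5 : ℂ) • vecMulVec v v, ?_⟩, fun a => ?_⟩
  · rw [mem_unitaryGroup_iff', star_eq_conjTranspose, conjTranspose_sub, conjTranspose_smul,
      conjTranspose_vecMulVec, hstar]
    simp only [conjTranspose_one, sub_mul, mul_sub, one_mul, mul_one, smul_mul_smul_comm,
      vecMulVec_mul_vecMulVec, hv, vecMulVec_smul, smul_smul]
    ext a b
    simp
    ring
  · by_cases h₁ : a = p <;> by_cases h₂ : a = q <;>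
      simp_all [v, vecMulVec_apply, Pi.single_apply, one_apply, eq_comm] <;> norm_num

variable [MeasurableSpace (unitaryGroup n ℂ)] [BorelSpace (unitaryGroup n ℂ)]
  (μ : Measure (unitaryGroup n ℂ))

lemma integrable_columnMoment [IsFiniteMeasure μ] (i k j j' l l' : n) :
    Integrable (fun U : unitaryGroup n ℂ =>
      (starRingEnd ℂ) ((U : Matrix n n ℂ) j i) * (U : Matrix n n ℂ) j' i *
      (starRingEnd ℂ) ((U : Matrix n n ℂ) l k) * (U : Matrix n n ℂ) l' k) μ := by
  have hcont (a b : n) : Continuous fun U : unitaryGroup n ℂ => (U : Matrix n n ℂ) a b :=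
    continuous_subtype_val.matrix_elem a b
  refine Integrable.of_bound (C := 1) (Continuous.aestronglyMeasurable ?_)
    (Filter.Eventually.of_forall fun U => ?_)
  · exact (((Complex.continuous_conj.comp (hcont j i)).mul (hcont j' i)).mul
      (Complex.continuous_conj.comp (hcont l k))).mul (hcont l' k)
  · have hU (a b : n) := entry_norm_bound_of_unitary U.2 a b
    simp only [norm_mul, RCLike.norm_conj]
    exact mul_le_one₀ (mul_le_one₀ (mul_le_one₀ (hU j i) (norm_nonneg _) (hU j' i))
      (norm_nonneg _) (hU l k)) (norm_nonneg _) (hU l' k)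

lemma sum_columnMoment [IsProbabilityMeasure μ] (i k : n) :
    ∑ j, ∑ l, columnMoment μ i k j j l l = 1 := by
  have hint := integrable_columnMoment μ i k
  simp only [columnMoment]
  simp_rw [← integral_finsetSum _ fun l _ => hint _ _ l l]
  rw [← integral_finsetSum _ fun j _ => integrable_finsetSum _ fun l _ => hint j j l l]
  have h (U : unitaryGroup n ℂ) : ∑ j, ∑ l, (starRingEnd ℂ) ((U : Matrix n n ℂ) j i) *
      (U : Matrix n n ℂ) j i * (starRingEnd ℂ) ((U : Matrix n n ℂ) l k) *
      (U : Matrix n n ℂ) l k = 1 := by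
    simp_rw [mul_assoc _ ((starRingEnd ℂ) _), ← Finset.mul_sum, ← Finset.sum_mul,
      sum_conj_mul_unitaryGroup]
    simp
  simp [h]

lemma sum_columnMoment_swap [IsProbabilityMeasure μ] (i k : n) :
    ∑ j, ∑ l, columnMoment μ i k j l l j = if i = k then 1 else 0 := by
  have hint := integrable_columnMoment μ i k
  simp only [columnMoment]
  simp_rw [← integral_finsetSum _ fun l _ => hint _ l l _]
  rw [← integral_finsetSum _ fun j _ => integrable_finsetSum _ fun l _ => hint j l l j]
  have h (U : unitaryGroup n ℂ) : ∑ j, ∑ l, (starRingEnd ℂ) ((U : Matrix n n ℂ) j i) *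
      (U : Matrix n n ℂ) l i * (starRingEnd ℂ) ((U : Matrix n n ℂ) l k) *
      (U : Matrix n n ℂ) j k = if i = k then 1 else 0 := by
    calc _ = (∑ j, (starRingEnd ℂ) ((U : Matrix n n ℂ) j i) * (U : Matrix n n ℂ) j k) *
        ∑ l, (starRingEnd ℂ) ((U : Matrix n n ℂ) l k) * (U : Matrix n n ℂ) l i := by
          rw [Finset.sum_mul_sum]
          refine Finset.sum_congr rfl fun j _ => Finset.sum_congr rfl fun l _ => ?_
          ring
      _ = _ := by
          simp only [sum_conj_mul_unitaryGroup]
          by_cases hik : i = k <;> simp [hik]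
  simp [h]

variable [μ.IsMulLeftInvariant]

lemma columnMoment_eq_sum [IsFiniteMeasure μ] (V : unitaryGroup n ℂ) (i k j j' l l' : n) :
    columnMoment μ i k j j' l l' = ∑ a, ∑ b, ∑ c, ∑ e,
      (starRingEnd ℂ) ((V : Matrix n n ℂ) j a) * (V : Matrix n n ℂ) j' b *
      (starRingEnd ℂ) ((V : Matrix n n ℂ) l c) * (V : Matrix n n ℂ) l' e *
        columnMoment μ i k a b c e := by
  have hint := integrable_columnMoment μ i k
  conv_lhs => rw [columnMoment, ← integral_mul_left_eq_self _ V]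
  simp only [columnMoment, ← integral_const_mul]
  simp_rw [← integral_finsetSum _ fun e _ => (hint _ _ _ e).const_mul _]
  simp_rw [← integral_finsetSum _ fun c _ =>
    integrable_finsetSum _ fun e _ => (hint _ _ c e).const_mul _]
  simp_rw [← integral_finsetSum _ fun b _ => integrable_finsetSum _ fun c _ =>
    integrable_finsetSum _ fun e _ => (hint _ b c e).const_mul _]
  rw [← integral_finsetSum _ fun a _ => integrable_finsetSum _ fun b _ =>
    integrable_finsetSum _ fun c _ => integrable_finsetSum _ fun e _ =>
      (hint a b c e).const_mul _]
  congr 1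
  ext U
  simp only [UnitaryGroup.mul_val, mul_apply, map_sum, map_mul]
  have hprod (f g h k : n → ℂ) : (∑ a, f a) * (∑ b, g b) * (∑ c, h c) * (∑ e, k e) =
      ∑ a, ∑ b, ∑ c, ∑ e, f a * g b * h c * k e := by
    simp_rw [← Finset.mul_sum, ← Finset.sum_mul, ← Finset.mul_sum, ← Finset.sum_mul,
      ← Finset.mul_sum, ← Finset.sum_mul]
  rw [hprod]
  refine Finset.sum_congr rfl fun a _ => Finset.sum_congr rfl fun b _ =>
    Finset.sum_congr rfl fun c _ => Finset.sum_congr rfl fun e _ => ?_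
  ring

lemma columnMoment_perm [IsFiniteMeasure μ] (σ : Equiv.Perm n) (i k j j' l l' : n) :
    columnMoment μ i k j j' l l' = columnMoment μ i k (σ j) (σ j') (σ l) (σ l') := by
  rw [columnMoment_eq_sum μ ⟨_, permMatrix_mem_unitaryGroup σ⟩]
  simp [PEquiv.toMatrix_apply, Equiv.toPEquiv_apply]

lemma columnMoment_phase [IsFiniteMeasure μ] {c : n → ℂ} (hc : ∀ a, star (c a) * c a = 1)
    (i k j j' l l' : n) :
    columnMoment μ i k j j' l l' = (starRingEnd ℂ) (c j) * c j' * (starRingEnd ℂ) (c l) * c l' *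
      columnMoment μ i k j j' l l' := by
  conv_lhs => rw [columnMoment_eq_sum μ ⟨_, diagonal_mem_unitaryGroup hc⟩]
  simp [diagonal_apply, apply_ite]

lemma columnMoment_eq_zero [IsFiniteMeasure μ] (i k : n) {j j' l l' : n}
    (h : ¬(j = j' ∧ l = l')) (h' : ¬(j = l' ∧ l = j')) :
    columnMoment μ i k j j' l l' = 0 := by
  have key (p : n) := columnMoment_phase μ (c := fun a => if a = p then Complex.I else 1)
    (by intro a; by_cases ha : a = p <;> simp [ha]) i k j j' l l'
  have hI : Complex.I ≠ 1 := fun h => by simpa using congrArg Complex.re h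
  have hI' : -Complex.I ≠ 1 := fun h => by simpa using congrArg Complex.re h
  have hm (z : ℂ) (hz : z ≠ 1) (e : columnMoment μ i k j j' l l' =
      z * columnMoment μ i k j j' l l') : columnMoment μ i k j j' l l' = 0 := by
    by_contra h0
    exact hz (mul_right_cancel₀ h0 (by rw [one_mul, ← e]))
  by_cases hj : j = j' ∨ j = l'
  · by_cases hl : l = j' ∨ l = l'
    · rcases hj with rfl | rfl
      · have hjl : l = j := by tauto
        subst hjl
        refine hm _ ?_ (key l')
        have : l ≠ l' := by tauto
        simpa [this] using hI
      · have hjl : l = j := by tauto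
        subst hjl
        refine hm _ ?_ (key j')
        have : l ≠ j' := by tauto
        simpa [this] using hI
    · push Not at hl
      refine hm _ ?_ (key l)
      by_cases hjl : j = l
      · exact absurd hj (by simp [hjl, hl])
      · simpa [hl.1.symm, hl.2.symm, hjl] using hI'
  · push Not at hj
    refine hm _ ?_ (key j)
    by_cases hjl : l = j
    · subst hjl
      norm_num [hj.1.symm, hj.2.symm]
    · simpa [hj.1.symm, hj.2.symm, hjl] using hI'

lemma columnMoment_self [IsFiniteMeasure μ] (i k : n) {p q : n} (hpq : p ≠ q) :
    columnMoment μ i k p p p p = columnMoment μ i k p p q q + columnMoment μ i k p q q p := by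
  obtain ⟨V, hV⟩ := exists_unitaryGroup_row hpq
  have h := columnMoment_eq_sum μ V i k p p p p
  have hz {a b c e : n} := columnMoment_eq_zero μ i k (j := a) (j' := b) (l := c) (l' := e)
  simp only [hV, map_add, apply_ite (starRingEnd ℂ), map_div₀, map_neg, map_ofNat, map_zero,
    add_mul, mul_add, ite_mul, mul_ite, zero_mul, mul_zero, Finset.sum_add_distrib,
    Finset.sum_ite_eq', Finset.mem_univ, if_true] at h
  have hs₀ := columnMoment_perm μ (Equiv.swap p q) i k p p p p
  have hs₁ := columnMoment_perm μ (Equiv.swap p q) i k p p q q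
  have hs₂ := columnMoment_perm μ (Equiv.swap p q) i k p q q p
  simp only [Equiv.swap_apply_left, Equiv.swap_apply_right] at hs₀ hs₁ hs₂
  simp only [hz (a := p) (b := p) (c := p) (e := q) (by tauto) (by tauto),
    hz (a := p) (b := p) (c := q) (e := p) (by tauto) (by tauto),
    hz (a := p) (b := q) (c := p) (e := p) (by tauto) (by tauto),
    hz (a := q) (b := p) (c := p) (e := p) (by tauto) (by tauto),
    hz (a := q) (b := q) (c := q) (e := p) (by tauto) (by tauto),
    hz (a := q) (b := q) (c := p) (e := q) (by tauto) (by tauto),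
    hz (a := q) (b := p) (c := q) (e := q) (by tauto) (by tauto),
    hz (a := p) (b := q) (c := q) (e := q) (by tauto) (by tauto),
    hz (a := p) (b := q) (c := p) (e := q) (by tauto) (by tauto),
    hz (a := q) (b := p) (c := q) (e := p) (by tauto) (by tauto),
    ← hs₀, ← hs₁, ← hs₂] at h
  linear_combination (625 / 288 : ℂ) * h

/-- By left invariance, the moments are those of a combination of the identity and the swap. -/
lemma exists_columnMoment_eq [IsFiniteMeasure μ] [Nontrivial n] (i k : n) :
    ∃ A B : ℂ, ∀ j j' l l' : n, columnMoment μ i k j j' l l' =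
      A * ((if j = j' then 1 else 0) * (if l = l' then 1 else 0)) +
      B * ((if j = l' then 1 else 0) * (if l = j' then 1 else 0)) := by
  obtain ⟨p, q, hpq⟩ := exists_pair_ne n
  have hperm {j l : n} (hjl : j ≠ l) : ∃ σ : Equiv.Perm n, σ p = j ∧ σ q = l := by
    refine ⟨Equiv.swap (Equiv.swap p j q) l * Equiv.swap p j, ?_, by simp⟩
    rw [Equiv.Perm.mul_apply, Equiv.swap_apply_left, Equiv.swap_apply_of_ne_of_ne _ hjl]
    intro h
    exact hpq ((Equiv.swap p j).injective (by rw [Equiv.swap_apply_left]; exact h))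
  refine ⟨columnMoment μ i k p p q q, columnMoment μ i k p q q p, fun j j' l l' => ?_⟩
  by_cases h : j = j' ∧ l = l'
  · obtain ⟨rfl, rfl⟩ := h
    by_cases hjl : j = l
    · subst hjl
      rw [columnMoment_perm μ (Equiv.swap j p)]
      simpa using columnMoment_self μ i k hpq
    · obtain ⟨σ, rfl, rfl⟩ := hperm hjl
      rw [← columnMoment_perm μ σ]
      simp [hpq]
  · by_cases h' : j = l' ∧ l = j'
    · obtain ⟨rfl, rfl⟩ := h'
      have hjl : j ≠ l := by tauto
      obtain ⟨σ, rfl, rfl⟩ := hperm hjl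
      rw [← columnMoment_perm μ σ]
      simp [hpq]
    · rw [columnMoment_eq_zero μ i k h h']
      simp only [← ite_and, mul_ite, mul_one, mul_zero]
      rw [if_neg (by tauto), if_neg (by tauto), add_zero]

end FourthMoments

/-- Entrywise form of the Choi matrix of the Haar-averaged doubled von Neumann
measurement channel `∫ 𝒫_U ⊗ 𝒫_U dU`:
`∫ conj(U_{ji}) U_{j'i} conj(U_{lk}) U_{l'k} dμ(U)
  = (1/(d²−1)) [ (δ_{jj'}δ_{ll'} − (1/d) δ_{jl'}δ_{lj'})
      + δ_{ik} (δ_{jl'}δ_{lj'} − (1/d) δ_{jj'}δ_{ll'}) ]`. -/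
theorem haar_averaged_measurement_choi (d : ℕ) (hd : 2 ≤ d)
    [MeasurableSpace (Matrix.unitaryGroup (Fin d) ℂ)]
    [BorelSpace (Matrix.unitaryGroup (Fin d) ℂ)]
    (μ : Measure (Matrix.unitaryGroup (Fin d) ℂ))
    [μ.IsHaarMeasure] [IsProbabilityMeasure μ]
    (i k j j' l l' : Fin d) :
    ∫ U : Matrix.unitaryGroup (Fin d) ℂ,
        (starRingEnd ℂ) ((U : Matrix (Fin d) (Fin d) ℂ) j i) *
          (U : Matrix (Fin d) (Fin d) ℂ) j' i *
          (starRingEnd ℂ) ((U : Matrix (Fin d) (Fin d) ℂ) l k) *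
          (U : Matrix (Fin d) (Fin d) ℂ) l' k ∂μ
      = (1 / ((d : ℂ) ^ 2 - 1)) *
          (((if j = j' then 1 else 0) * (if l = l' then 1 else 0) -
              (1 / (d : ℂ)) * ((if j = l' then 1 else 0) * (if l = j' then 1 else 0))) +
            (if i = k then 1 else 0) *
              ((if j = l' then 1 else 0) * (if l = j' then 1 else 0) -
                (1 / (d : ℂ)) * ((if j = j' then 1 else 0) * (if l = l' then 1 else 0)))) := by
  have : Nontrivial (Fin d) := Fin.nontrivial_iff_two_le.2 hd
  obtain ⟨A, B, hAB⟩ := exists_columnMoment_eq μ i k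
  have h₁ := sum_columnMoment μ i k
  have h₂ := sum_columnMoment_swap μ i k
  simp only [hAB, Finset.sum_add_distrib, ← Finset.mul_sum, if_true, mul_one, mul_ite,
    mul_zero, Finset.sum_const, Finset.card_univ, Fintype.card_fin, nsmul_eq_mul,
    Finset.sum_ite_eq', Finset.mem_univ] at h₁ h₂
  have hd₀ : (d : ℂ) ≠ 0 := by exact_mod_cast (by lia : d ≠ 0)
  have hd₁ : (d : ℂ) ^ 2 - 1 ≠ 0 := by
    rw [sub_ne_zero]
    exact_mod_cast (by nlinarith : d ^ 2 ≠ 1)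
  generalize (if i = k then (1 : ℂ) else 0) = t at h₂ ⊢
  have hA : A = 1 / ((d : ℂ) ^ 2 - 1) * (1 - t / d) := by
    field_simp
    linear_combination d * h₁ - h₂
  have hB : B = 1 / ((d : ℂ) ^ 2 - 1) * (t - 1 / d) := by
    field_simp
    linear_combination d * h₂ - h₁
  refine (hAB j j' l l').trans ?_
  rw [hA, hB]
  ring
end
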